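/- Let Φ₁(k,·,·) be the solution of the fixed-point equation Φ₁(k,u,c) = 1 + k² (T₀∘T_{2,2})Φ₁(k,u,c) on [u(0),u(1)]². Then there exist M₀ and constants C(k) > 0, C ≥ 1 such that for every k ≠ 0, all integers m ≥ m₁ ≥ 0, and all M ≥ M₀: (i) |∂_u^{m₁}∂_c^{m−m₁}Φ₁(k,u,c)| ≤ C(k) Γ_{s₀}(m)(2M)^m|k|^m on [u(0),u(1)]²; and (ii) |∂_u^{m₁}∂_c^{m−m₁}((Φ₁(k,u,c)−1)/(u−c)²)| ≤ C(k) Γ_{s₀}(m)(CM)^m|k|^m. -/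

import Mathlib

open MeasureTheory Set
open scoped ENNReal

noncomputable section

/-- `Γ_s(m) = (m!)^{1/s} (m+1)^{-2}`. -/
def GammaS (s : ℝ) (m : ℕ) : ℝ := ((m.factorial : ℝ)) ^ (1 / s) / ((m : ℝ) + 1) ^ 2

/-- Partial derivative in the first variable. -/
def pd1 (f : ℝ → ℝ → ℂ) : ℝ → ℝ → ℂ := fun x c => deriv (fun x' => f x' c) x

/-- Partial derivative in the second variable. -/
def pd2 (f : ℝ → ℝ → ℂ) : ℝ → ℝ → ℂ := fun x c => deriv (fun c' => f x c') c

/-- The operator `T_{2,2}` (with weight `w = (u⁻¹)'`):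
`T_{2,2}f(u₁,c) = (w(u₁)/(u₁−c)²) ∫_c^{u₁} (u₂−c)² w(u₂) f(u₂,c) du₂`. -/
def T22op (w : ℝ → ℝ) (f : ℝ → ℝ → ℂ) : ℝ → ℝ → ℂ :=
  fun u1 c => ((w u1 / (u1 - c) ^ 2 : ℝ) : ℂ) *
    ∫ u2 in c..u1, (((u2 - c) ^ 2 * w u2 : ℝ) : ℂ) * f u2 c

/-- The operator `T₀ f(u,c) = ∫_c^u f(u₁,c) du₁`. -/
def T0op (f : ℝ → ℝ → ℂ) : ℝ → ℝ → ℂ := fun x c => ∫ u1 in c..x, f u1 c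

section par
variable {E : Type} [NormedAddCommGroup E] [NormedSpace ℝ E]

lemma par_fderiv_contDiff {F : Type} [NormedAddCommGroup F] [NormedSpace ℝ F]
    (g : ℝ → E → F) (hg : ContDiff ℝ (⊤ : ℕ∞) (Function.uncurry g)) :
    ContDiff ℝ (⊤ : ℕ∞) (Function.uncurry (fun s x => fderiv ℝ (g s) x)) := by
  have : ContDiff ℝ (⊤ : ℕ∞) (fun q : ℝ × E => fderiv ℝ (g q.1) q.2) := by
    refine ContDiff.fderiv (n := (⊤ : ℕ∞)) (m := (⊤ : ℕ∞)) ?_ contDiff_snd (by simp)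
    exact hg.comp ((contDiff_fst.comp contDiff_fst).prodMk contDiff_snd)
  exact this

variable [ProperSpace E]

lemma par_hasFDerivAt {F : Type} [NormedAddCommGroup F] [NormedSpace ℝ F] [CompleteSpace F]
    (g : ℝ → E → F) (hg : ContDiff ℝ (⊤ : ℕ∞) (Function.uncurry g)) (p : E) :
    HasFDerivAt (fun x => ∫ s in (0:ℝ)..1, g s x) (∫ s in (0:ℝ)..1, fderiv ℝ (g s) p) p := by
  have hg' := par_fderiv_contDiff g hg
  have hc : Continuous (Function.uncurry (fun s x => fderiv ℝ (g s) x)) := hg'.continuous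
  have hcomp : IsCompact ((Icc (0:ℝ) 1) ×ˢ Metric.closedBall p 1) :=
    isCompact_Icc.prod (isCompact_closedBall p 1)
  obtain ⟨C, hC⟩ := hcomp.exists_bound_of_continuousOn hc.continuousOn
  have hsl : ∀ x, Continuous (fun s => g s x) := fun x =>
    hg.continuous.comp (continuous_id.prodMk continuous_const)
  have hsl' : ∀ x, Continuous (fun s => fderiv ℝ (g s) x) := fun x =>
    hc.comp (continuous_id.prodMk continuous_const)
  refine intervalIntegral.hasFDerivAt_integral_of_dominated_of_fderiv_le (bound := fun _ => C)
    (F := fun x s => g s x) (F' := fun x s => fderiv ℝ (g s) x)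
    (Metric.closedBall_mem_nhds p one_pos) ?_ ?_ ?_ ?_ ?_ ?_
  · exact Filter.Eventually.of_forall fun x => (hsl x).aestronglyMeasurable
  · exact (hsl p).intervalIntegrable _ _
  · exact (hsl' p).aestronglyMeasurable
  · refine Filter.Eventually.of_forall fun t ht x hx => ?_
    rw [uIoc_of_le zero_le_one] at ht
    exact hC (t, x) ⟨⟨ht.1.le, ht.2⟩, hx⟩
  · exact intervalIntegrable_const
  · refine Filter.Eventually.of_forall fun t ht x hx => ?_
    have : ContDiff ℝ (⊤ : ℕ∞) (g t) := hg.comp (contDiff_const.prodMk contDiff_id)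
    exact (this.differentiable (by simp) x).hasFDerivAt

lemma par_fderiv {F : Type} [NormedAddCommGroup F] [NormedSpace ℝ F] [CompleteSpace F]
    (g : ℝ → E → F) (hg : ContDiff ℝ (⊤ : ℕ∞) (Function.uncurry g)) :
    fderiv ℝ (fun x => ∫ s in (0:ℝ)..1, g s x) = fun x => ∫ s in (0:ℝ)..1, fderiv ℝ (g s) x :=
  funext fun p => (par_hasFDerivAt g hg p).fderiv

lemma par_contDiff_nat (n : ℕ) : ∀ {F : Type} [NormedAddCommGroup F] [NormedSpace ℝ F]
    [CompleteSpace F]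
    (g : ℝ → E → F) (_ : ContDiff ℝ (⊤ : ℕ∞) (Function.uncurry g)),
    ContDiff ℝ n (fun x => ∫ s in (0:ℝ)..1, g s x) := by
  induction n with
  | zero =>
    intro F _ _ _ g hg
    have : Differentiable ℝ (fun x => ∫ s in (0:ℝ)..1, g s x) :=
      fun p => (par_hasFDerivAt g hg p).differentiableAt
    simpa using (contDiff_zero (𝕜 := ℝ)).2 this.continuous
  | succ n ih =>
    intro F _ _ _ g hg
    have : ((n+1 : ℕ) : WithTop ℕ∞) = (n : WithTop ℕ∞) + 1 := by push_cast; rfl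
    rw [this, contDiff_succ_iff_fderiv]
    refine ⟨fun p => (par_hasFDerivAt g hg p).differentiableAt, by simp, ?_⟩
    rw [par_fderiv g hg]
    exact ih _ (par_fderiv_contDiff g hg)

lemma par_contDiff {F : Type} [NormedAddCommGroup F] [NormedSpace ℝ F]
    [CompleteSpace F]
    (g : ℝ → E → F) (hg : ContDiff ℝ (⊤ : ℕ∞) (Function.uncurry g)) :
    ContDiff ℝ (⊤ : ℕ∞) (fun x => ∫ s in (0:ℝ)..1, g s x) :=
  contDiff_infty.2 fun n => par_contDiff_nat n g hg

lemma par_bound (n : ℕ) : ∀ {F : Type} [NormedAddCommGroup F] [NormedSpace ℝ F]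
    [CompleteSpace F]
    (g : ℝ → E → F) (_ : ContDiff ℝ (⊤ : ℕ∞) (Function.uncurry g)) (p : E) (b : ℝ → ℝ)
    (_ : IntervalIntegrable b volume 0 1)
    (_ : ∀ s ∈ Icc (0:ℝ) 1, ‖iteratedFDeriv ℝ n (g s) p‖ ≤ b s),
    ‖iteratedFDeriv ℝ n (fun x => ∫ s in (0:ℝ)..1, g s x) p‖ ≤ ∫ s in (0:ℝ)..1, b s := by
  induction n with
  | zero =>
    intro F _ _ _ g hg p b hb h
    simp only [norm_iteratedFDeriv_zero] at h ⊢
    refine intervalIntegral.norm_integral_le_of_norm_le zero_le_one ?_ hb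
    exact Filter.Eventually.of_forall fun s hs => h s ⟨hs.1.le, hs.2⟩
  | succ n ih =>
    intro F _ _ _ g hg p b hb h
    rw [← norm_iteratedFDeriv_fderiv, par_fderiv g hg]
    refine ih _ (par_fderiv_contDiff g hg) p b hb ?_
    intro s hs
    have := h s hs
    rwa [← norm_iteratedFDeriv_fderiv] at this

end par

def facR (r : ℝ) (n : ℕ) : ℝ := (n.factorial : ℝ) ^ r

lemma facR_pos (r : ℝ) (n : ℕ) : 0 < facR r n :=
  Real.rpow_pos_of_pos (by exact_mod_cast n.factorial_pos) r

lemma facR_choose (r : ℝ) {n j : ℕ} (hj : j ≤ n) :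
    (n.choose j : ℝ) * (facR r j * facR r (n - j)) = facR r n * (n.choose j : ℝ) ^ (1 - r) := by
  have h : (n.factorial : ℝ) = n.choose j * (j.factorial * (n - j).factorial) := by
    rw [← mul_assoc]; exact_mod_cast (Nat.choose_mul_factorial_mul_factorial hj).symm
  have hc : (0:ℝ) < n.choose j := by exact_mod_cast Nat.choose_pos hj
  unfold facR
  rw [h, Real.mul_rpow hc.le (by positivity), Real.mul_rpow (by positivity) (by positivity),
    mul_right_comm, ← Real.rpow_add hc]
  simp

lemma rpow_choose_le_one {r : ℝ} (hr : 1 < r) {n j : ℕ} (hj : j ≤ n) :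
    (n.choose j : ℝ) ^ (1 - r) ≤ 1 :=
  Real.rpow_le_one_of_one_le_of_nonpos (by exact_mod_cast Nat.choose_pos hj) (by linarith)

lemma choose_ge (n : ℕ) : ∀ j, 1 ≤ j → j < n → n ≤ n.choose j := by
  induction n with
  | zero => intro j _ h; omega
  | succ n ih =>
    intro j h1 h2
    obtain ⟨j, rfl⟩ : ∃ i, j = i + 1 := ⟨j - 1, by omega⟩
    rw [Nat.choose_succ_succ']
    rcases Nat.lt_or_ge (j+1) n with h | h
    · have := ih (j+1) h1 h
      have := Nat.choose_pos (n := n) (k := j) (by omega)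
      omega
    · obtain rfl : n = j + 1 := by omega
      simp

def epsR (r : ℝ) (n : ℕ) : ℝ :=
  ∑ i ∈ Finset.range n, (1/2 : ℝ) ^ (i+1) * (n.choose (i+1) : ℝ) ^ (1 - r)

lemma sum_half_le (n : ℕ) : ∑ i ∈ Finset.range n, (1/2 : ℝ) ^ (i+1) ≤ 1 := by
  have : ∑ i ∈ Finset.range n, (1/2 : ℝ) ^ (i+1) = 1 - (1/2)^n := by
    induction n with
    | zero => simp
    | succ n ih => rw [Finset.sum_range_succ, ih]; ring
  rw [this]
  have : (0:ℝ) < (1/2)^n := by positivity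
  linarith

lemma epsR_le {r : ℝ} (hr : 1 < r) (k : ℕ) :
    epsR r (k+1) ≤ ((k:ℝ)+1) ^ (1 - r) + (1/2) ^ (k+1) := by
  unfold epsR
  rw [Finset.sum_range_succ]
  apply add_le_add
  · calc _ ≤ ∑ i ∈ Finset.range k, (1/2 : ℝ) ^ (i+1) * ((k:ℝ)+1) ^ (1 - r) := by
          refine Finset.sum_le_sum fun i hi => ?_
          have hi := Finset.mem_range.1 hi
          refine mul_le_mul_of_nonneg_left ?_ (by positivity)
          refine Real.rpow_le_rpow_of_nonpos (by positivity) ?_ (by linarith)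
          exact_mod_cast choose_ge (k+1) (i+1) (by omega) (by omega)
      _ = (∑ i ∈ Finset.range k, (1/2 : ℝ) ^ (i+1)) * ((k:ℝ)+1) ^ (1 - r) := by
          rw [Finset.sum_mul]
      _ ≤ 1 * ((k:ℝ)+1) ^ (1 - r) :=
          mul_le_mul_of_nonneg_right (sum_half_le k) (by positivity)
      _ = _ := one_mul _
  · simp

lemma epsR_tendsto {r : ℝ} (hr : 1 < r) :
    Filter.Tendsto (epsR r) Filter.atTop (nhds 0) := by
  rw [← Filter.tendsto_add_atTop_iff_nat 1]
  have h1 : Filter.Tendsto (fun k : ℕ => ((k:ℝ)+1) ^ (1 - r) + (1/2:ℝ) ^ (k+1)) Filter.atTop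
      (nhds (0 + 0)) := by
    apply Filter.Tendsto.add
    · have := (tendsto_rpow_neg_atTop (y := r - 1) (by linarith)).comp
        ((tendsto_natCast_atTop_atTop (R := ℝ)).comp (Filter.tendsto_add_atTop_nat 1))
      refine this.congr fun k => ?_
      simp
    · exact (tendsto_pow_atTop_nhds_zero_of_lt_one (by norm_num) (by norm_num)).comp
        (Filter.tendsto_add_atTop_nat 1)
  rw [add_zero] at h1
  refine tendsto_of_tendsto_of_tendsto_of_le_of_le tendsto_const_nhds h1 ?_ ?_
  · intro k; exact Finset.sum_nonneg fun i _ => by positivity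
  · intro k; exact epsR_le hr k

/-- all terms -/
lemma leib_full {r : ℝ} (hr : 1 < r) {a b : ℕ → ℝ} {A B ρ : ℝ} (hA : 0 ≤ A) (hB : 0 ≤ B)
    (hρ : 0 < ρ) (ha0 : ∀ i, 0 ≤ a i) (ha : ∀ i, a i ≤ A * facR r i * ρ ^ i)
    (hb : ∀ i, b i ≤ B * facR r i * ρ ^ i) (n : ℕ) :
    ∑ i ∈ Finset.range (n+1), (n.choose i : ℝ) * a i * b (n - i)
      ≤ (A * B) * facR r n * (2 * ρ) ^ n := by
  have key : ∀ i ∈ Finset.range (n+1), (n.choose i : ℝ) * a i * b (n - i)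
      ≤ (A * B) * facR r n * ρ ^ n := by
    intro i hi
    have hi : i ≤ n := by have := Finset.mem_range.1 hi; omega
    have e1 := facR_pos r i
    have e2 := facR_pos r (n - i)
    have e3 := facR_pos r n
    calc (n.choose i : ℝ) * a i * b (n - i)
        ≤ n.choose i * (A * facR r i * ρ ^ i) * (B * facR r (n-i) * ρ ^ (n-i)) := by
              refine (mul_le_mul_of_nonneg_left (hb (n-i)) (mul_nonneg (by positivity) (ha0 i))).trans ?_
              refine mul_le_mul_of_nonneg_right
                (mul_le_mul_of_nonneg_left (ha i) (by positivity)) (by positivity)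
      _ = (A * B) * (n.choose i * (facR r i * facR r (n-i))) * (ρ ^ i * ρ ^ (n-i)) := by ring
      _ = (A * B) * (facR r n * (n.choose i : ℝ) ^ (1 - r)) * ρ ^ n := by
          rw [facR_choose r hi, ← pow_add, Nat.add_sub_cancel' hi]
      _ ≤ (A * B) * (facR r n * 1) * ρ ^ n := by
          have := rpow_choose_le_one hr hi
          gcongr
      _ = _ := by ring
  have h2 : ((n:ℝ) + 1) ≤ 2 ^ n := by exact_mod_cast Nat.lt_two_pow_self (n := n)
  have e3 := facR_pos r n
  calc _ ≤ ∑ i ∈ Finset.range (n+1), (A * B) * facR r n * ρ ^ n := Finset.sum_le_sum key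
    _ = (A * B) * facR r n * ρ ^ n * ((n:ℝ)+1) := by simp; ring
    _ ≤ (A * B) * facR r n * ρ ^ n * 2 ^ n := by gcongr
    _ = _ := by rw [mul_pow]; ring

lemma leib_part {r : ℝ} {a b : ℕ → ℝ} {A B ρ : ℝ} (hB : 0 ≤ B)
    (hρ : 0 < ρ) (ha0 : ∀ i, 0 ≤ a i) (ha : ∀ i, a i ≤ A * facR r i * ρ ^ i)
    (n : ℕ) (hb : ∀ i < n, b i ≤ B * facR r i * (2 * ρ) ^ i) :
    ∑ i ∈ Finset.range (n+1), (n.choose i : ℝ) * a i * b (n - i)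
      ≤ (A * B) * facR r n * (2 * ρ) ^ n * epsR r n + a 0 * b n := by
  rw [Finset.sum_range_succ']
  apply add_le_add
  · unfold epsR
    rw [Finset.mul_sum]
    refine Finset.sum_le_sum fun j hj => ?_
    have hj := Finset.mem_range.1 hj
    obtain ⟨i, hi'⟩ : ∃ i, i = j + 1 := ⟨_, rfl⟩
    rw [← hi']
    have hi : i ≤ n := by omega
    have e1 := facR_pos r i
    have e2 := facR_pos r (n - i)
    have e3 := facR_pos r n
    calc (n.choose i : ℝ) * a i * b (n - i)
        ≤ n.choose i * (A * facR r i * ρ ^ i) * (B * facR r (n-i) * (2 * ρ) ^ (n-i)) := by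
              refine (mul_le_mul_of_nonneg_left (hb (n-i) (by omega))
                (mul_nonneg (by positivity) (ha0 i))).trans ?_
              refine mul_le_mul_of_nonneg_right
                (mul_le_mul_of_nonneg_left (ha i) (by positivity)) (by positivity)
      _ = (A * B) * (n.choose i * (facR r i * facR r (n-i))) * ((1/2)^i * ((2 * ρ) ^ i * (2 * ρ) ^ (n-i))) := by
          have : ρ ^ i = (1/2)^i * (2 * ρ) ^ i := by rw [← mul_pow]; congr 1; ring
          rw [this]; ring
      _ = (A * B) * (facR r n * (n.choose i : ℝ) ^ (1 - r)) * ((1/2)^i * (2 * ρ) ^ n) := by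
          rw [facR_choose r hi, ← pow_add, Nat.add_sub_cancel' hi]
      _ = _ := by ring
  · simp


lemma comp_right_le {E G F : Type} [NormedAddCommGroup E] [NormedSpace ℝ E]
    [NormedAddCommGroup G] [NormedSpace ℝ G] [NormedAddCommGroup F] [NormedSpace ℝ F]
    (L : G →L[ℝ] E) (hL : ‖L‖ ≤ 1) (f : E → F) (hf : ContDiff ℝ (⊤ : ℕ∞) f) (x : G) (i : ℕ) :
    ‖iteratedFDeriv ℝ i (fun y => f (L y)) x‖ ≤ ‖iteratedFDeriv ℝ i f (L x)‖ := by
  have h := L.iteratedFDeriv_comp_right hf x (i := i) (by exact_mod_cast le_top)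
  have h' : (f ∘ L) = fun y => f (L y) := rfl
  rw [h'] at h
  rw [h]
  refine (ContinuousMultilinearMap.norm_compContinuousLinearMap_le _ _).trans ?_
  refine mul_le_of_le_one_right (norm_nonneg _) ?_
  exact Finset.prod_le_one (fun _ _ => norm_nonneg _) (fun _ _ => hL)

def XL (τ : ℝ) : ℝ × ℝ →L[ℝ] ℝ :=
  ContinuousLinearMap.snd ℝ ℝ ℝ + τ • (ContinuousLinearMap.fst ℝ ℝ ℝ - ContinuousLinearMap.snd ℝ ℝ ℝ)

lemma XL_apply (τ : ℝ) (p : ℝ × ℝ) : XL τ p = p.2 + τ * (p.1 - p.2) := by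
  simp [XL]

def YL (τ : ℝ) : ℝ × ℝ →L[ℝ] ℝ × ℝ := (XL τ).prod (ContinuousLinearMap.snd ℝ ℝ ℝ)

lemma YL_apply (τ : ℝ) (p : ℝ × ℝ) : YL τ p = (p.2 + τ * (p.1 - p.2), p.2) := by
  simp [YL, XL_apply]

lemma XL_norm {τ : ℝ} (h : τ ∈ Icc (0:ℝ) 1) : ‖XL τ‖ ≤ 1 := by
  refine ContinuousLinearMap.opNorm_le_bound _ zero_le_one fun p => ?_
  have h1 : |p.1| ≤ ‖p‖ := norm_fst_le p
  have h2 : |p.2| ≤ ‖p‖ := norm_snd_le p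
  rw [XL_apply, one_mul, Real.norm_eq_abs]
  obtain ⟨a, b⟩ := h
  rw [abs_le] at *
  constructor <;> nlinarith

lemma YL_norm {τ : ℝ} (h : τ ∈ Icc (0:ℝ) 1) : ‖YL τ‖ ≤ 1 := by
  refine ContinuousLinearMap.opNorm_le_bound _ zero_le_one fun p => ?_
  have h1 := (XL τ).le_of_opNorm_le (XL_norm h) p
  rw [XL_apply] at h1
  rw [YL_apply, Prod.norm_mk]
  exact max_le h1 (by rw [one_mul]; exact norm_snd_le p)

lemma XL_mem {α β τ : ℝ} (h : τ ∈ Icc (0:ℝ) 1) {p : ℝ × ℝ} (hp : p ∈ Ioo α β ×ˢ Ioo α β) :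
    XL τ p ∈ Ioo α β := by
  rw [XL_apply]
  have := (convex_Ioo α β).add_smul_sub_mem hp.2 hp.1 h
  simpa using this

def gI (v : ℝ × ℝ → ℝ) (w : ℝ → ℝ) (P : ℝ × ℝ → ℂ) (σ θ : ℝ) (p : ℝ × ℝ) : ℂ :=
  (σ * θ ^ 2) • ((v p * (w (XL σ p) * w (XL (σ * θ) p))) • P (YL (σ * θ) p))

def HI (v : ℝ × ℝ → ℝ) (w : ℝ → ℝ) (P : ℝ × ℝ → ℂ) (p : ℝ × ℝ) : ℂ :=
  ∫ σ in (0:ℝ)..1, ∫ θ in (0:ℝ)..1, gI v w P σ θ p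

section
variable {v : ℝ × ℝ → ℝ} {w : ℝ → ℝ} {P : ℝ × ℝ → ℂ}

lemma gI_contDiff (hv : ContDiff ℝ (⊤ : ℕ∞) v)
    (hw : ContDiff ℝ (⊤ : ℕ∞) w) (hP : ContDiff ℝ (⊤ : ℕ∞) P) : ContDiff ℝ (⊤ : ℕ∞)
    (fun q : ℝ × (ℝ × (ℝ × ℝ)) => gI v w P q.2.1 q.1 q.2.2) := by
  unfold gI
  simp only [XL_apply, YL_apply]
  fun_prop

lemma gI_inner_contDiff (hv : ContDiff ℝ (⊤ : ℕ∞) v)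
    (hw : ContDiff ℝ (⊤ : ℕ∞) w) (hP : ContDiff ℝ (⊤ : ℕ∞) P) : ContDiff ℝ (⊤ : ℕ∞)
    (Function.uncurry (fun (σ : ℝ) (p : ℝ × ℝ) => ∫ θ in (0:ℝ)..1, gI v w P σ θ p)) := by
  have := par_contDiff (E := ℝ × (ℝ × ℝ)) (fun θ q => gI v w P q.1 θ q.2)
    (gI_contDiff hv hw hP)
  exact this

lemma HI_contDiff (hv : ContDiff ℝ (⊤ : ℕ∞) v)
    (hw : ContDiff ℝ (⊤ : ℕ∞) w) (hP : ContDiff ℝ (⊤ : ℕ∞) P) : ContDiff ℝ (⊤ : ℕ∞) (HI v w P) :=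
  par_contDiff (E := ℝ × ℝ) (fun σ p => ∫ θ in (0:ℝ)..1, gI v w P σ θ p)
    (gI_inner_contDiff hv hw hP)

lemma HI_bound (hv : ContDiff ℝ (⊤ : ℕ∞) v)
    (hw : ContDiff ℝ (⊤ : ℕ∞) w) (hP : ContDiff ℝ (⊤ : ℕ∞) P) (n : ℕ) (p : ℝ × ℝ) (R : ℝ)
    (h : ∀ σ ∈ Icc (0:ℝ) 1, ∃ b : ℝ → ℝ, IntervalIntegrable b volume 0 1 ∧
      (∀ θ ∈ Icc (0:ℝ) 1, ‖iteratedFDeriv ℝ n (gI v w P σ θ) p‖ ≤ b θ) ∧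
      ∫ θ in (0:ℝ)..1, b θ ≤ R) :
    ‖iteratedFDeriv ℝ n (HI v w P) p‖ ≤ R := by
  have := par_bound n (E := ℝ × ℝ) (fun σ p => ∫ θ in (0:ℝ)..1, gI v w P σ θ p)
    (gI_inner_contDiff hv hw hP) p (fun _ => R) intervalIntegrable_const ?_
  · rw [intervalIntegral.integral_const, sub_zero, one_smul] at this
    exact this
  intro σ hσ
  obtain ⟨b, hb, h1, h2⟩ := h σ hσ
  refine (par_bound n (E := ℝ × ℝ) (fun θ p => gI v w P σ θ p) ?_ p b hb h1).trans h2
  exact (gI_contDiff hv hw hP).comp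
    (contDiff_fst.prodMk (contDiff_const.prodMk contDiff_snd))

lemma gI_le (hv : ContDiff ℝ (⊤ : ℕ∞) v)
    (hw : ContDiff ℝ (⊤ : ℕ∞) w) (hP : ContDiff ℝ (⊤ : ℕ∞) P) (n : ℕ) (p : ℝ × ℝ) {σ θ : ℝ} (hσ : σ ∈ Icc (0:ℝ) 1) (hθ : θ ∈ Icc (0:ℝ) 1) :
    ‖iteratedFDeriv ℝ n (gI v w P σ θ) p‖ ≤ (σ * θ ^ 2) *
      ∑ i ∈ Finset.range (n + 1), (n.choose i : ℝ) *
        ‖iteratedFDeriv ℝ i (fun p => v p * (w (XL σ p) * w (XL (σ * θ) p))) p‖ *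
        ‖iteratedFDeriv ℝ (n - i) P (YL (σ * θ) p)‖ := by
  have hτ : σ * θ ∈ Icc (0:ℝ) 1 :=
    ⟨mul_nonneg hσ.1 hθ.1, mul_le_one₀ hσ.2 hθ.1 hθ.2⟩
  have hcf : ContDiff ℝ (⊤ : ℕ∞) (fun p => v p * (w (XL σ p) * w (XL (σ * θ) p))) := by
    fun_prop
  have hcP : ContDiff ℝ (⊤ : ℕ∞) (fun p => P (YL (σ * θ) p)) := by fun_prop
  have hn : (n : WithTop ℕ∞) ≤ ((⊤ : ℕ∞) : WithTop ℕ∞) := by exact_mod_cast le_top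
  have e : gI v w P σ θ = (σ * θ ^ 2) • (fun p => (v p * (w (XL σ p) * w (XL (σ * θ) p))) •
    P (YL (σ * θ) p)) := rfl
  have hsm : ContDiff ℝ (⊤ : ℕ∞) (fun p => (v p * (w (XL σ p) * w (XL (σ * θ) p))) •
    P (YL (σ * θ) p)) := hcf.smul hcP
  rw [e, iteratedFDeriv_const_smul_apply ((hsm.of_le hn).contDiffAt), norm_smul,
    Real.norm_eq_abs, abs_of_nonneg (mul_nonneg hσ.1 (sq_nonneg θ))]
  refine mul_le_mul_of_nonneg_left ?_ (mul_nonneg hσ.1 (sq_nonneg θ))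
  refine (norm_iteratedFDeriv_smul_le hcf hcP p hn).trans ?_
  refine Finset.sum_le_sum fun i _ => ?_
  refine mul_le_mul_of_nonneg_left ?_ (by positivity)
  exact comp_right_le _ (YL_norm hτ) P hP p _
end

/-- bound for the coefficient -/
lemma coef_bound {v : ℝ × ℝ → ℝ} {w : ℝ → ℝ} (hv : ContDiff ℝ (⊤ : ℕ∞) v)
    (hw : ContDiff ℝ (⊤ : ℕ∞) w) {r : ℝ} (hr : 1 < r) {α β V W κ : ℝ} (hV : 0 ≤ V) (hW : 0 ≤ W)
    (hκ : 1 ≤ κ)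
    (hwb : ∀ x ∈ Ioo α β, ∀ i, |iteratedDeriv i w x| ≤ W * facR r i * κ ^ i)
    {p : ℝ × ℝ} (hp : p ∈ Ioo α β ×ˢ Ioo α β)
    (hvb : ∀ i, ‖iteratedFDeriv ℝ i v p‖ ≤ V * facR r i * (2 * κ) ^ i)
    {σ τ : ℝ} (hσ : σ ∈ Icc (0:ℝ) 1) (hτ : τ ∈ Icc (0:ℝ) 1) (i : ℕ) :
    ‖iteratedFDeriv ℝ i (fun p => v p * (w (XL σ p) * w (XL τ p))) p‖ ≤
      (V * (W * W)) * facR r i * (4 * κ) ^ i := by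
  have hn : ∀ n : ℕ, (n : WithTop ℕ∞) ≤ ((⊤ : ℕ∞) : WithTop ℕ∞) := by
    intro n; exact_mod_cast le_top
  have h1 : ∀ τ ∈ Icc (0:ℝ) 1, ∀ i, ‖iteratedFDeriv ℝ i (fun p => w (XL τ p)) p‖ ≤
      W * facR r i * κ ^ i := by
    intro τ hτ i
    refine (comp_right_le _ (XL_norm hτ) w hw p i).trans ?_
    rw [norm_iteratedFDeriv_eq_norm_iteratedDeriv]
    exact hwb _ (XL_mem hτ hp) i
  have hc : ∀ τ, ContDiff ℝ (⊤ : ℕ∞) (fun p => w (XL τ p)) := fun τ => by fun_prop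
  have h2 : ∀ i, ‖iteratedFDeriv ℝ i (fun p => w (XL σ p) * w (XL τ p)) p‖ ≤
      (W * W) * facR r i * (2 * κ) ^ i := by
    intro i
    refine (norm_iteratedFDeriv_mul_le (hc σ) (hc τ) p (hn i)).trans ?_
    exact leib_full hr (a := fun i => ‖iteratedFDeriv ℝ i (fun p => w (XL σ p)) p‖)
      (b := fun i => ‖iteratedFDeriv ℝ i (fun p => w (XL τ p)) p‖) hW hW (by linarith)
      (fun _ => norm_nonneg _) (h1 σ hσ) (h1 τ hτ) i
  refine (norm_iteratedFDeriv_mul_le hv ((hc σ).mul (hc τ)) p (hn i)).trans ?_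
  have := leib_full hr (a := fun i => ‖iteratedFDeriv ℝ i v p‖)
      (b := fun i => ‖iteratedFDeriv ℝ i (fun p => w (XL σ p) * w (XL τ p)) p‖) hV
      (mul_nonneg hW hW) (by linarith)
      (fun _ => norm_nonneg _) hvb h2 i
  rw [show 4 * κ = 2 * (2 * κ) by ring]
  exact this

lemma exp_int {a l : ℝ} (hl : 0 < l) :
    ∫ θ in (0:ℝ)..1, a * Real.exp (l * a * θ) ≤ Real.exp (l * a) / l := by
  have h : ∀ θ ∈ uIcc (0:ℝ) 1, HasDerivAt (fun θ => Real.exp (l * a * θ) / l)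
      (a * Real.exp (l * a * θ)) θ := by
    intro θ _
    have h1 : HasDerivAt (fun θ => l * a * θ) (l * a) θ := by
      simpa using (hasDerivAt_id θ).const_mul (l * a)
    refine (h1.exp.div_const l).congr_deriv ?_
    field_simp
  rw [intervalIntegral.integral_eq_sub_of_hasDerivAt h
    (Continuous.intervalIntegrable (by fun_prop) _ _)]
  have : 0 < Real.exp (l * a * 0) / l := by positivity
  rw [mul_one]
  linarith


lemma facR_ge_one {r : ℝ} (hr : 1 < r) (n : ℕ) : 1 ≤ facR r n :=
  Real.one_le_rpow (by exact_mod_cast n.factorial_pos) (by linarith)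

lemma facR_zero (r : ℝ) : facR r 0 = 1 := by simp [facR]

def qv (p : ℝ × ℝ) : ℝ := (p.1 - p.2) * (p.1 - p.2)

lemma qv_contDiff : ContDiff ℝ (⊤ : ℕ∞) qv := by unfold qv; fun_prop

lemma ell_bound {r : ℝ} (hr : 1 < r) {L κ : ℝ} (hκ : 1 ≤ κ) {p : ℝ × ℝ}
    (hp : |p.1 - p.2| ≤ L) (i : ℕ) :
    ‖iteratedFDeriv ℝ i (fun p : ℝ × ℝ => p.1 - p.2) p‖ ≤ (L + 2) * facR r i * κ ^ i := by
  have hL : 0 ≤ L := (abs_nonneg _).trans hp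
  have hf := facR_ge_one hr i
  have hk : 1 ≤ κ ^ i := one_le_pow₀ hκ
  have hmul : L + 2 ≤ (L + 2) * facR r i * κ ^ i := by
    have : L + 2 ≤ (L + 2) * facR r i := le_mul_of_one_le_right (by linarith) hf
    exact this.trans (le_mul_of_one_le_right (by linarith) hk)
  refine le_trans ?_ hmul
  match i with
  | 0 => rw [norm_iteratedFDeriv_zero, Real.norm_eq_abs]; linarith
  | i + 1 =>
    rw [← norm_iteratedFDeriv_fderiv]
    set D : ℝ × ℝ →L[ℝ] ℝ := ContinuousLinearMap.fst ℝ ℝ ℝ - ContinuousLinearMap.snd ℝ ℝ ℝ with hD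
    have : fderiv ℝ (fun p : ℝ × ℝ => p.1 - p.2) = fun _ => D := by
      funext p
      exact D.hasFDerivAt.fderiv
    rw [this]
    match i with
    | 0 =>
      rw [norm_iteratedFDeriv_zero]
      have : ‖D‖ ≤ 1 + 1 := (norm_sub_le _ _).trans
        (add_le_add (ContinuousLinearMap.norm_fst_le _ _ _) (ContinuousLinearMap.norm_snd_le _ _ _))
      linarith
    | i + 1 =>
      rw [iteratedFDeriv_succ_const]
      simp; linarith

lemma qv_bound {r : ℝ} (hr : 1 < r) {L κ : ℝ} (hκ : 1 ≤ κ) {p : ℝ × ℝ}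
    (hp : |p.1 - p.2| ≤ L) (i : ℕ) :
    ‖iteratedFDeriv ℝ i qv p‖ ≤ ((L + 2) * (L + 2)) * facR r i * (2 * κ) ^ i := by
  have hL : 0 ≤ L := (abs_nonneg _).trans hp
  have hc : ContDiff ℝ (⊤ : ℕ∞) (fun p : ℝ × ℝ => p.1 - p.2) := by fun_prop
  refine (norm_iteratedFDeriv_mul_le hc hc p (n := i) (by exact_mod_cast le_top)).trans ?_
  exact leib_full hr (a := fun i => ‖iteratedFDeriv ℝ i (fun p : ℝ × ℝ => p.1 - p.2) p‖)
      (b := fun i => ‖iteratedFDeriv ℝ i (fun p : ℝ × ℝ => p.1 - p.2) p‖)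
      (by linarith) (by linarith) (by linarith)
      (fun _ => norm_nonneg _) (ell_bound hr hκ hp) (ell_bound hr hκ hp) i

lemma YL_mem {α β τ : ℝ} (h : τ ∈ Icc (0:ℝ) 1) {p : ℝ × ℝ} (hp : p ∈ Ioo α β ×ˢ Ioo α β) :
    YL τ p ∈ Ioo α β ×ˢ Ioo α β := by
  have := XL_mem h hp
  rw [XL_apply] at this
  rw [YL_apply]
  exact ⟨this, hp.2⟩

lemma mul_mem_unit {σ θ : ℝ} (hσ : σ ∈ Icc (0:ℝ) 1) (hθ : θ ∈ Icc (0:ℝ) 1) :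
    σ * θ ∈ Icc (0:ℝ) 1 :=
  ⟨mul_nonneg hσ.1 hθ.1, mul_le_one₀ hσ.2 hθ.1 hθ.2⟩

lemma HI_full {v : ℝ × ℝ → ℝ} {w : ℝ → ℝ} {P : ℝ × ℝ → ℂ} (hv : ContDiff ℝ (⊤ : ℕ∞) v)
    (hw : ContDiff ℝ (⊤ : ℕ∞) w) (hP : ContDiff ℝ (⊤ : ℕ∞) P)
    {r : ℝ} (hr : 1 < r) {α β V W κ K : ℝ} (hV : 0 ≤ V) (hW : 0 ≤ W)
    (hκ : 1 ≤ κ) (hK : 0 ≤ K)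
    (hwb : ∀ x ∈ Ioo α β, ∀ i, |iteratedDeriv i w x| ≤ W * facR r i * κ ^ i)
    (hvb : ∀ p ∈ Ioo α β ×ˢ Ioo α β, ∀ i,
      ‖iteratedFDeriv ℝ i v p‖ ≤ V * facR r i * (2 * κ) ^ i)
    (hPb : ∀ p ∈ Ioo α β ×ˢ Ioo α β, ∀ i,
      ‖iteratedFDeriv ℝ i P p‖ ≤ K * facR r i * (8 * κ) ^ i)
    {p : ℝ × ℝ} (hp : p ∈ Ioo α β ×ˢ Ioo α β) (n : ℕ) :
    ‖iteratedFDeriv ℝ n (HI v w P) p‖ ≤ (V * (W * W) * K) * facR r n * (16 * κ) ^ n := by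
  have e3 := facR_pos r n
  have hR : 0 ≤ (V * (W * W) * K) * facR r n * (16 * κ) ^ n := by positivity
  refine HI_bound hv hw hP n p _ fun σ hσ => ⟨fun _ => _, intervalIntegrable_const, ?_, 
    (by rw [intervalIntegral.integral_const, sub_zero, one_smul])⟩
  intro θ hθ
  have hτ := mul_mem_unit hσ hθ
  refine (gI_le hv hw hP n p hσ hθ).trans ?_
  have h1 : σ * θ ^ 2 ≤ 1 := by
    have := mul_mem_unit hτ hθ
    rw [mul_assoc, ← sq] at this
    exact this.2
  have h0 : 0 ≤ σ * θ ^ 2 := mul_nonneg hσ.1 (sq_nonneg θ)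
  have h2 := leib_full hr (ρ := 8 * κ)
      (a := fun i => ‖iteratedFDeriv ℝ i (fun p => v p * (w (XL σ p) * w (XL (σ * θ) p))) p‖)
      (b := fun i => ‖iteratedFDeriv ℝ i P (YL (σ * θ) p)‖)
      (A := V * (W * W)) (B := K)
      (by positivity) hK (by linarith) (fun _ => norm_nonneg _)
      (fun i => by
        refine (coef_bound hv hw hr hV hW hκ hwb hp (hvb p hp) hσ hτ i).trans ?_
        have := facR_pos r i
        gcongr
        norm_num) (hPb _ (YL_mem hτ hp)) n
  rw [show 2 * (8 * κ) = 16 * κ by ring] at h2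
  calc _ ≤ 1 * ((V * (W * W) * K) * facR r n * (16 * κ) ^ n) :=
        mul_le_mul h1 h2 (Finset.sum_nonneg fun i _ => by positivity) zero_le_one
    _ = _ := one_mul _

lemma HI_top {w : ℝ → ℝ} {P : ℝ × ℝ → ℂ}
    (hw : ContDiff ℝ (⊤ : ℕ∞) w) (hP : ContDiff ℝ (⊤ : ℕ∞) P)
    {r : ℝ} (hr : 1 < r) {α β V W κ K A l : ℝ} (hV : 0 ≤ V) (hW : 0 ≤ W)
    (hκ : 1 ≤ κ) (hK : 0 ≤ K) (hA : 0 ≤ A) (hl : 0 < l)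
    (hwb : ∀ x ∈ Ioo α β, ∀ i, |iteratedDeriv i w x| ≤ W * facR r i * κ ^ i)
    (hvb : ∀ p ∈ Ioo α β ×ˢ Ioo α β, ∀ i,
      ‖iteratedFDeriv ℝ i qv p‖ ≤ V * facR r i * (2 * κ) ^ i) (n : ℕ)
    (hPb : ∀ p ∈ Ioo α β ×ˢ Ioo α β, ∀ i < n,
      ‖iteratedFDeriv ℝ i P p‖ ≤ K * facR r i * (8 * κ) ^ i)
    (hPn : ∀ p ∈ Ioo α β ×ˢ Ioo α β,
      ‖iteratedFDeriv ℝ n P p‖ ≤ A * Real.exp (l * |p.1 - p.2|))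
    {p : ℝ × ℝ} (hp : p ∈ Ioo α β ×ˢ Ioo α β) :
    ‖iteratedFDeriv ℝ n (HI qv w P) p‖ ≤
      (V * (W * W) * K) * facR r n * (8 * κ) ^ n * epsR r n +
      ((β - α) * (W * W) * A) * (Real.exp (l * |p.1 - p.2|) / l) := by
  have e3 := facR_pos r n
  have e4 : 0 ≤ epsR r n := Finset.sum_nonneg fun i _ => by positivity
  set R := (V * (W * W) * K) * facR r n * (8 * κ) ^ n * epsR r n with hRdef
  have hR : 0 ≤ R := by positivity
  set t := |p.1 - p.2| with ht
  have ht0 : 0 ≤ t := abs_nonneg _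
  have htL : t ≤ β - α := by
    obtain ⟨⟨a1, a2⟩, ⟨b1, b2⟩⟩ := hp
    rw [ht, abs_le]; constructor <;> linarith
  set D := (β - α) * (W * W) * A with hD
  have hLn : 0 ≤ β - α := ht0.trans htL
  have hD0 : 0 ≤ D := by positivity
  refine HI_bound qv_contDiff hw hP n p _ fun σ hσ =>
    ⟨fun θ => R + D * ((σ * t) * Real.exp (l * (σ * t) * θ)),
      Continuous.intervalIntegrable (by fun_prop) _ _, ?_, ?_⟩
  · intro θ hθ
    have hτ := mul_mem_unit hσ hθ
    refine (gI_le qv_contDiff hw hP n p hσ hθ).trans ?_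
    have h0 : 0 ≤ σ * θ ^ 2 := mul_nonneg hσ.1 (sq_nonneg θ)
    have hθ2 : θ ^ 2 ≤ 1 := pow_le_one₀ hθ.1 hθ.2
    have h1 : σ * θ ^ 2 ≤ σ := mul_le_of_le_one_right hσ.1 hθ2
    have h2 := leib_part (r := r) (ρ := 4 * κ)
      (a := fun i => ‖iteratedFDeriv ℝ i (fun p => qv p * (w (XL σ p) * w (XL (σ * θ) p))) p‖)
      (b := fun i => ‖iteratedFDeriv ℝ i P (YL (σ * θ) p)‖)
      (A := V * (W * W)) (B := K)
      hK (by linarith) (fun _ => norm_nonneg _)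
      (fun i => coef_bound qv_contDiff hw hr hV hW hκ hwb hp (hvb p hp) hσ hτ i) n
      (by rw [show 2 * (4 * κ) = 8 * κ by ring]; exact hPb _ (YL_mem hτ hp))
    rw [show 2 * (4 * κ) = 8 * κ by ring, ← hRdef] at h2
    have hw0 : ∀ τ ∈ Icc (0:ℝ) 1, |w (XL τ p)| ≤ W := by
      intro τ hτ
      simpa [facR_zero] using hwb _ (XL_mem hτ hp) 0
    have h3 : ‖iteratedFDeriv ℝ 0 (fun p => qv p * (w (XL σ p) * w (XL (σ * θ) p))) p‖
        ≤ t * (β - α) * (W * W) := by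
      rw [norm_iteratedFDeriv_zero, norm_mul, norm_mul]
      have hq : ‖qv p‖ = t * t := by
        rw [qv, norm_mul, Real.norm_eq_abs]
      rw [hq]
      have := hw0 σ hσ
      have := hw0 _ hτ
      simp only [Real.norm_eq_abs]
      gcongr
    have h4 : ‖iteratedFDeriv ℝ n P (YL (σ * θ) p)‖ ≤ A * Real.exp (l * (σ * t) * θ) := by
      have := hPn _ (YL_mem hτ hp)
      rw [YL_apply] at this ⊢
      simp only [add_sub_cancel_left, abs_mul] at this
      rw [abs_of_nonneg hσ.1, abs_of_nonneg hθ.1, ← ht] at this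
      rwa [show l * (σ * t) * θ = l * (σ * θ * t) by ring]
    calc _ ≤ (σ * θ ^ 2) * (R + (t * (β - α) * (W * W)) * (A * Real.exp (l * (σ * t) * θ))) := by
          refine mul_le_mul_of_nonneg_left (h2.trans ?_) h0
          gcongr
      _ ≤ σ * (R + (t * (β - α) * (W * W)) * (A * Real.exp (l * (σ * t) * θ))) := by
          gcongr
      _ = σ * R + D * ((σ * t) * Real.exp (l * (σ * t) * θ)) := by rw [hD]; ring
      _ ≤ _ := by
          have := mul_le_of_le_one_left hR hσ.2
          exact add_le_add this le_rfl
  · have e7 : ∫ θ in (0:ℝ)..1, (R + D * ((σ * t) * Real.exp (l * (σ * t) * θ)))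
        = R + D * ∫ θ in (0:ℝ)..1, (σ * t) * Real.exp (l * (σ * t) * θ) := by
      rw [intervalIntegral.integral_add intervalIntegrable_const
        (Continuous.intervalIntegrable (by fun_prop) _ _),
        intervalIntegral.integral_const, sub_zero, one_smul]
      congr 1
      exact intervalIntegral.integral_const_mul _ _
    rw [e7]
    have h5 := exp_int (a := σ * t) hl
    have h6 : Real.exp (l * (σ * t)) ≤ Real.exp (l * t) := by
      apply Real.exp_le_exp.2
      exact mul_le_mul_of_nonneg_left (mul_le_of_le_one_left ht0 hσ.2) hl.le
    have h7 : Real.exp (l * (σ * t)) / l ≤ Real.exp (l * t) / l := by gcongr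
    exact add_le_add le_rfl (mul_le_mul_of_nonneg_left (h5.trans h7) hD0)

lemma half_trick {ι : Type} {S : Set ι} (h : ι → ℝ) (h0 : ∀ p ∈ S, 0 ≤ h p)
    {A0 R : ℝ} (hb : ∀ p ∈ S, h p ≤ A0)
    (step : ∀ A, 0 ≤ A → (∀ p ∈ S, h p ≤ A) → ∀ p ∈ S, h p ≤ A / 2 + R) :
    ∀ p ∈ S, h p ≤ 2 * R := by
  intro p hp
  have hne : (h '' S).Nonempty := ⟨_, p, hp, rfl⟩
  have hbd : BddAbove (h '' S) := ⟨A0, by rintro _ ⟨q, hq, rfl⟩; exact hb q hq⟩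
  have hle : ∀ q ∈ S, h q ≤ sSup (h '' S) := fun q hq => le_csSup hbd ⟨q, hq, rfl⟩
  have h1 : 0 ≤ sSup (h '' S) := (h0 p hp).trans (hle p hp)
  have h2 : sSup (h '' S) ≤ sSup (h '' S) / 2 + R := by
    apply csSup_le hne
    rintro _ ⟨q, hq, rfl⟩
    exact step _ h1 hle q hq
  have := hle p hp
  linarith


lemma eq_deriv_bound {P H : ℝ × ℝ → ℂ} {U : Set (ℝ × ℝ)} (hU : IsOpen U) {k2 : ℝ} (hk2 : 0 ≤ k2)
    (hH : ContDiff ℝ (⊤ : ℕ∞) H) (heq : ∀ p ∈ U, P p = 1 + k2 • H p) {n : ℕ} (hn : 1 ≤ n)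
    {p : ℝ × ℝ} (hp : p ∈ U) :
    ‖iteratedFDeriv ℝ n P p‖ ≤ k2 * ‖iteratedFDeriv ℝ n H p‖ := by
  have hn' : (n : WithTop ℕ∞) ≤ ((⊤ : ℕ∞) : WithTop ℕ∞) := by exact_mod_cast le_top
  have he : P =ᶠ[nhds p] ((fun _ => (1:ℂ)) + k2 • H) := by
    filter_upwards [hU.mem_nhds hp] with q hq
    exact heq q hq
  rw [(he.iteratedFDeriv ℝ n).eq_of_nhds]
  have hH' : ContDiff ℝ (⊤ : ℕ∞) (k2 • H) := hH.const_smul k2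
  rw [iteratedFDeriv_add_apply contDiffAt_const (hH'.of_le hn').contDiffAt,
    iteratedFDeriv_const_smul_apply (hH.of_le hn').contDiffAt,
    iteratedFDeriv_const_of_ne (by omega)]
  simp [norm_smul, abs_of_nonneg hk2]

lemma main1 {w : ℝ → ℝ} {P : ℝ × ℝ → ℂ}
    (hw : ContDiff ℝ (⊤ : ℕ∞) w) (hP : ContDiff ℝ (⊤ : ℕ∞) P)
    {r : ℝ} (hr : 1 < r) {α β W κ k2 : ℝ} (hαβ : α < β) (hW : 0 ≤ W) (hk2 : 0 ≤ k2)
    (hκ : 1 ≤ κ)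
    (hwb : ∀ x ∈ Ioo α β, ∀ i, |iteratedDeriv i w x| ≤ W * facR r i * κ ^ i)
    (heq : ∀ p ∈ Ioo α β ×ˢ Ioo α β, P p = 1 + k2 • HI qv w P p) :
    ∃ K, 0 ≤ K ∧ ∀ p ∈ Ioo α β ×ˢ Ioo α β, ∀ n,
      ‖iteratedFDeriv ℝ n P p‖ ≤ K * facR r n * (8 * κ) ^ n := by
  have hQo : IsOpen (Ioo α β ×ˢ Ioo α β) := isOpen_Ioo.prod isOpen_Ioo
  set L := β - α with hL
  have hL0 : 0 < L := by linarith
  have htL : ∀ p ∈ Ioo α β ×ˢ Ioo α β, |p.1 - p.2| ≤ L := by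
    rintro p ⟨⟨a1, a2⟩, ⟨b1, b2⟩⟩
    rw [abs_le]; constructor <;> linarith
  set V := (L + 2) * (L + 2) with hVdef
  have hV : 0 ≤ V := by positivity
  have hvb : ∀ p ∈ Ioo α β ×ˢ Ioo α β, ∀ i,
      ‖iteratedFDeriv ℝ i qv p‖ ≤ V * facR r i * (2 * κ) ^ i :=
    fun p hp i => qv_bound hr hκ (htL p hp) i
  -- boundedness
  have hbd : ∀ i : ℕ, ∃ A, 0 ≤ A ∧ ∀ p ∈ Ioo α β ×ˢ Ioo α β, ‖iteratedFDeriv ℝ i P p‖ ≤ A := by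
    intro i
    have hc : Continuous (iteratedFDeriv ℝ i P) :=
      hP.continuous_iteratedFDeriv (by exact_mod_cast le_top)
    obtain ⟨C, hC⟩ := (isCompact_Icc.prod isCompact_Icc :
      IsCompact (Icc α β ×ˢ Icc α β)).exists_bound_of_continuousOn hc.continuousOn
    refine ⟨max C 0, le_max_right _ _, fun p hp => (hC p ?_).trans (le_max_left _ _)⟩
    exact ⟨Ioo_subset_Icc_self hp.1, Ioo_subset_Icc_self hp.2⟩
  choose A hA0 hA using hbd
  set l := 2 * k2 * (L * (W * W)) + 1 with hl
  have hl0 : 0 < l := by positivity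
  -- threshold
  obtain ⟨n₀, hn₀⟩ : ∃ n₀ : ℕ, ∀ n ≥ n₀, 2 * k2 * (V * (W * W)) * Real.exp (l * L) * epsR r n ≤ 1 := by
    have h1 := (epsR_tendsto hr).const_mul (2 * k2 * (V * (W * W)) * Real.exp (l * L))
    rw [mul_zero] at h1
    have := h1.eventually (gt_mem_nhds (zero_lt_one))
    obtain ⟨n₀, h⟩ := Filter.eventually_atTop.1 this
    exact ⟨n₀, fun n hn => (h n hn).le⟩
  set K := ∑ i ∈ Finset.range (n₀ + 1), A i with hKdef
  have hK : 0 ≤ K := Finset.sum_nonneg fun i _ => hA0 i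
  refine ⟨K, hK, ?_⟩
  suffices h : ∀ n, ∀ p ∈ Ioo α β ×ˢ Ioo α β,
      ‖iteratedFDeriv ℝ n P p‖ ≤ K * facR r n * (8 * κ) ^ n from fun p hp n => h n p hp
  intro n
  induction n using Nat.strong_induction_on with
  | _ n ih =>
  have e3 := facR_pos r n
  rcases Nat.lt_or_ge n (n₀ + 1) with hn | hn
  · intro p hp
    have h1 : A n ≤ K := Finset.single_le_sum (f := A) (fun i _ => hA0 i) (Finset.mem_range.2 hn)
    have h2 : K ≤ K * facR r n * (8 * κ) ^ n := by
      have : K ≤ K * facR r n := le_mul_of_one_le_right hK (facR_ge_one hr n)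
      exact this.trans (le_mul_of_one_le_right (by positivity) (one_le_pow₀ (by linarith)))
    exact (hA n p hp).trans (h1.trans h2)
  · set R := (V * (W * W) * K) * facR r n * (8 * κ) ^ n * epsR r n with hR
    have e4 : 0 ≤ epsR r n := Finset.sum_nonneg fun i _ => by positivity
    have hR0 : 0 ≤ R := by positivity
    have key := half_trick (S := Ioo α β ×ˢ Ioo α β)
      (fun p => Real.exp (-(l * |p.1 - p.2|)) * ‖iteratedFDeriv ℝ n P p‖)
      (fun p _ => by positivity) (A0 := A n) (R := k2 * R)
      (fun p hp => by
        refine (mul_le_of_le_one_left (norm_nonneg _) ?_).trans (hA n p hp)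
        apply Real.exp_le_one_iff.2
        have : 0 ≤ l * |p.1 - p.2| := by positivity
        linarith)
      (fun B hB hBp p hp => by
        have hPn : ∀ p ∈ Ioo α β ×ˢ Ioo α β,
            ‖iteratedFDeriv ℝ n P p‖ ≤ B * Real.exp (l * |p.1 - p.2|) := by
          intro p hp
          have := hBp p hp
          rw [Real.exp_neg, inv_mul_le_iff₀ (Real.exp_pos _)] at this
          rwa [mul_comm]
        have h1 := HI_top hw hP hr hV hW hκ hK hB hl0 hwb hvb n
          (fun p hp i hi => ih i hi p hp) hPn hp
        rw [← hR, ← hL] at h1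
        have h2 := (eq_deriv_bound hQo hk2 (HI_contDiff qv_contDiff hw hP) heq (by omega) hp).trans
          (mul_le_mul_of_nonneg_left h1 hk2)
        set e := Real.exp (l * |p.1 - p.2|) with he
        have he1 : 1 ≤ e := Real.one_le_exp (by positivity)
        show Real.exp (-(l * |p.1 - p.2|)) * ‖iteratedFDeriv ℝ n P p‖ ≤ _
        rw [Real.exp_neg, ← he, inv_mul_le_iff₀ (by linarith)]
        refine h2.trans ?_
        have h3 : k2 * (L * (W * W)) / l ≤ 1 / 2 := by
          rw [div_le_iff₀ hl0, hl]; linarith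
        have h4 : k2 * R ≤ e * (k2 * R) := le_mul_of_one_le_left (by positivity) he1
        have h5 : k2 * (L * (W * W)) / l * (B * e) ≤ 1 / 2 * (B * e) := by gcongr
        calc k2 * (R + L * (W * W) * B * (e / l))
            = k2 * R + k2 * (L * (W * W)) / l * (B * e) := by ring
          _ ≤ e * (k2 * R) + 1 / 2 * (B * e) := add_le_add h4 h5
          _ = _ := by ring)
    intro p hp
    have h1 := key p hp
    rw [Real.exp_neg, inv_mul_le_iff₀ (Real.exp_pos _)] at h1
    have h2 : Real.exp (l * |p.1 - p.2|) ≤ Real.exp (l * L) :=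
      Real.exp_le_exp.2 (mul_le_mul_of_nonneg_left (htL p hp) hl0.le)
    have h3 := hn₀ n (by omega)
    calc _ ≤ _ := h1
      _ ≤ Real.exp (l * L) * (2 * (k2 * R)) := by gcongr
      _ = (2 * k2 * (V * (W * W)) * Real.exp (l * L) * epsR r n) * (K * facR r n * (8 * κ) ^ n) := by
          rw [hR]; ring
      _ ≤ 1 * (K * facR r n * (8 * κ) ^ n) := by gcongr
      _ = _ := one_mul _


lemma HI_qv (w : ℝ → ℝ) (P : ℝ × ℝ → ℂ) (p : ℝ × ℝ) :
    HI qv w P p = qv p • HI (fun _ => 1) w P p := by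
  unfold HI
  rw [← intervalIntegral.integral_smul]
  congr 1; funext σ
  rw [← intervalIntegral.integral_smul]
  congr 1; funext θ
  unfold gI
  simp only [smul_smul]
  congr 1; ring

lemma T22_eq (w : ℝ → ℝ) (f : ℝ → ℝ → ℂ) (c ρ : ℝ) :
    T22op w f (c + ρ) c = ((ρ * w (c + ρ) : ℝ) : ℂ) *
      ∫ θ in (0:ℝ)..1, ((θ ^ 2 * w (c + ρ * θ) : ℝ) : ℂ) * f (c + ρ * θ) c := by
  unfold T22op
  have h := intervalIntegral.smul_integral_comp_add_mul (a := (0:ℝ)) (b := 1)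
    (fun u2 => (((u2 - c) ^ 2 * w u2 : ℝ) : ℂ) * f u2 c) ρ c
  simp only [mul_zero, add_zero, mul_one] at h
  rw [← h]
  have h2 : ∀ θ : ℝ, (((c + ρ * θ - c) ^ 2 * w (c + ρ * θ) : ℝ) : ℂ) * f (c + ρ * θ) c =
      ((ρ ^ 2 : ℝ) : ℂ) * (((θ ^ 2 * w (c + ρ * θ) : ℝ) : ℂ) * f (c + ρ * θ) c) := by
    intro θ; push_cast; ring
  simp only [h2]
  rw [intervalIntegral.integral_const_mul]
  rw [Complex.real_smul, ← mul_assoc, ← mul_assoc]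
  congr 1
  by_cases hρ : ρ = 0
  · simp [hρ]
  · rw [add_sub_cancel_left]
    norm_cast
    field_simp

lemma T_eq (w : ℝ → ℝ) (f : ℝ → ℝ → ℂ) (x c : ℝ) :
    T0op (T22op w f) x c = HI qv w (fun p => f p.1 p.2) (x, c) := by
  rw [HI_qv]
  unfold T0op HI
  have h := intervalIntegral.smul_integral_comp_add_mul (a := (0:ℝ)) (b := 1)
    (fun u1 => T22op w f u1 c) (x - c) c
  simp only [mul_zero, add_zero, mul_one, add_sub_cancel] at h
  rw [← h]
  simp only [qv]
  rw [← smul_smul]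
  congr 1
  rw [← intervalIntegral.integral_smul]
  congr 1; funext σ
  rw [T22_eq, ← intervalIntegral.integral_const_mul, ← intervalIntegral.integral_smul]
  congr 1; funext θ
  unfold gI
  simp only [XL_apply, YL_apply, Complex.real_smul]
  have e1 : c + (x - c) * σ = c + σ * (x - c) := by ring
  have e2 : c + (x - c) * σ * θ = c + σ * θ * (x - c) := by ring
  rw [e1, e2]
  push_cast
  ring

abbrev unc (f : ℝ → ℝ → ℂ) : ℝ × ℝ → ℂ := fun p => f p.1 p.2

def SmOn (U : Set (ℝ × ℝ)) (f : ℝ → ℝ → ℂ) : Prop :=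
  ∀ p ∈ U, ContDiffAt ℝ (⊤ : ℕ∞) (unc f) p

lemma pd1_eq {f : ℝ → ℝ → ℂ} {p : ℝ × ℝ} (h : DifferentiableAt ℝ (unc f) p) :
    HasDerivAt (fun x => f x p.2) (fderiv ℝ (unc f) p (1, 0)) p.1 := by
  have h1 : HasDerivAt (fun x : ℝ => (x, p.2)) ((1:ℝ), (0:ℝ)) p.1 :=
    (hasDerivAt_id p.1).prodMk (hasDerivAt_const p.1 p.2)
  have h2 : HasFDerivAt (unc f) (fderiv ℝ (unc f) p) ((fun x : ℝ => (x, p.2)) p.1) :=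
    h.hasFDerivAt
  exact h2.comp_hasDerivAt p.1 h1

lemma pd2_eq {f : ℝ → ℝ → ℂ} {p : ℝ × ℝ} (h : DifferentiableAt ℝ (unc f) p) :
    HasDerivAt (fun c => f p.1 c) (fderiv ℝ (unc f) p (0, 1)) p.2 := by
  have h1 : HasDerivAt (fun c : ℝ => (p.1, c)) ((0:ℝ), (1:ℝ)) p.2 :=
    (hasDerivAt_const p.2 p.1).prodMk (hasDerivAt_id p.2)
  have h2 : HasFDerivAt (unc f) (fderiv ℝ (unc f) p) ((fun c : ℝ => (p.1, c)) p.2) :=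
    h.hasFDerivAt
  exact h2.comp_hasDerivAt p.2 h1

lemma dir_step {f g : ℝ × ℝ → ℂ} {e : ℝ × ℝ} (he : ‖e‖ ≤ 1) {p : ℝ × ℝ}
    (hf : ContDiffAt ℝ (⊤ : ℕ∞) f p) (hg : g =ᶠ[nhds p] fun q => fderiv ℝ f q e) :
    ContDiffAt ℝ (⊤ : ℕ∞) g p ∧
      ∀ n, ‖iteratedFDeriv ℝ n g p‖ ≤ ‖iteratedFDeriv ℝ (n + 1) f p‖ := by
  have hd : ContDiffAt ℝ (⊤ : ℕ∞) (fderiv ℝ f) p := hf.fderiv_right (by simp)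
  refine ⟨ContDiffAt.congr_of_eventuallyEq (hd.clm_apply contDiffAt_const) hg, fun n => ?_⟩
  rw [(hg.iteratedFDeriv ℝ n).eq_of_nhds, ← norm_iteratedFDeriv_fderiv]
  refine (norm_iteratedFDeriv_clm_apply_const hd (n := n) (by exact_mod_cast le_top)).trans ?_
  exact mul_le_of_le_one_left (norm_nonneg _) he

lemma pd1_step {U : Set (ℝ × ℝ)} (hU : IsOpen U) {f : ℝ → ℝ → ℂ} (hf : SmOn U f) :
    SmOn U (pd1 f) ∧ ∀ p ∈ U, ∀ n,
      ‖iteratedFDeriv ℝ n (unc (pd1 f)) p‖ ≤ ‖iteratedFDeriv ℝ (n + 1) (unc f) p‖ := by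
  have key : ∀ p ∈ U, _ := fun p hp => dir_step (e := (1, 0)) (g := unc (pd1 f)) (by simp) (hf p hp) (by
    filter_upwards [hU.mem_nhds hp] with q hq
    exact (pd1_eq ((hf q hq).differentiableAt (by simp))).deriv)
  exact ⟨fun p hp => (key p hp).1, fun p hp => (key p hp).2⟩

lemma pd2_step {U : Set (ℝ × ℝ)} (hU : IsOpen U) {f : ℝ → ℝ → ℂ} (hf : SmOn U f) :
    SmOn U (pd2 f) ∧ ∀ p ∈ U, ∀ n,
      ‖iteratedFDeriv ℝ n (unc (pd2 f)) p‖ ≤ ‖iteratedFDeriv ℝ (n + 1) (unc f) p‖ := by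
  have key : ∀ p ∈ U, _ := fun p hp => dir_step (e := (0, 1)) (g := unc (pd2 f)) (by simp) (hf p hp) (by
    filter_upwards [hU.mem_nhds hp] with q hq
    exact (pd2_eq ((hf q hq).differentiableAt (by simp))).deriv)
  exact ⟨fun p hp => (key p hp).1, fun p hp => (key p hp).2⟩

lemma iter_step (T : (ℝ → ℝ → ℂ) → (ℝ → ℝ → ℂ)) {U : Set (ℝ × ℝ)}
    (hT : ∀ f, SmOn U f → SmOn U (T f) ∧ ∀ p ∈ U, ∀ n,
      ‖iteratedFDeriv ℝ n (unc (T f)) p‖ ≤ ‖iteratedFDeriv ℝ (n + 1) (unc f) p‖) (a : ℕ) :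
    ∀ f, SmOn U f → SmOn U (T^[a] f) ∧ ∀ p ∈ U, ∀ n,
      ‖iteratedFDeriv ℝ n (unc (T^[a] f)) p‖ ≤ ‖iteratedFDeriv ℝ (n + a) (unc f) p‖ := by
  induction a with
  | zero => intro f hf; exact ⟨hf, fun p hp n => le_rfl⟩
  | succ a ih =>
    intro f hf
    rw [Function.iterate_succ_apply']
    obtain ⟨h1, h2⟩ := ih f hf
    obtain ⟨h3, h4⟩ := hT _ h1
    refine ⟨h3, fun p hp n => (h4 p hp n).trans ((h2 p hp (n+1)).trans_eq ?_)⟩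
    rw [show n + 1 + a = n + (a + 1) by ring]

lemma pd_bound {U : Set (ℝ × ℝ)} (hU : IsOpen U) {f : ℝ → ℝ → ℂ} (hf : SmOn U f) (a b : ℕ) :
    SmOn U (pd1^[a] (pd2^[b] f)) ∧ ∀ p ∈ U,
      ‖(pd1^[a] (pd2^[b] f)) p.1 p.2‖ ≤ ‖iteratedFDeriv ℝ (a + b) (unc f) p‖ := by
  obtain ⟨h1, h2⟩ := iter_step pd2 (fun f hf => pd2_step hU hf) b f hf
  obtain ⟨h3, h4⟩ := iter_step pd1 (fun f hf => pd1_step hU hf) a _ h1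
  refine ⟨h3, fun p hp => ?_⟩
  have := (h4 p hp 0).trans (h2 p hp (0 + a))
  rwa [norm_iteratedFDeriv_zero, zero_add] at this

lemma deriv_diag {h : ℝ → ℂ} {α β c K : ℝ} (hαβ : α < β) (hc : c ∈ Icc α β) (hK : 0 ≤ K)
    (hd : ∀ x ∈ Icc α β, x ≠ c → DifferentiableAt ℝ h x ∧ ‖deriv h x‖ ≤ K) :
    ‖deriv h c‖ ≤ K := by
  by_cases hdc : DifferentiableAt ℝ h c
  swap
  · rw [deriv_zero_of_not_differentiableAt hdc]; simpa using hK
  obtain ⟨S, hconv, hS, hne⟩ : ∃ S : Set ℝ, Convex ℝ S ∧ (∀ x ∈ S, x ∈ Icc α β ∧ x ≠ c) ∧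
      (nhdsWithin c S).NeBot := by
    rcases lt_or_ge c β with h | h
    · exact ⟨Ioo c β, convex_Ioo _ _, fun x hx => ⟨⟨hc.1.trans hx.1.le, hx.2.le⟩, hx.1.ne'⟩,
        left_nhdsWithin_Ioo_neBot h⟩
    · have : α < c := lt_of_lt_of_le hαβ h
      exact ⟨Ioo α c, convex_Ioo _ _, fun x hx => ⟨⟨hx.1.le, hx.2.le.trans hc.2⟩, hx.2.ne⟩,
        right_nhdsWithin_Ioo_neBot this⟩
  have h1 : ∀ x ∈ S, ∀ y ∈ S, ‖h y - h x‖ ≤ K * ‖y - x‖ := fun x hx y hy =>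
    hconv.norm_image_sub_le_of_norm_deriv_le (fun z hz => (hd z (hS z hz).1 (hS z hz).2).1)
      (fun z hz => (hd z (hS z hz).1 (hS z hz).2).2) hx hy
  have h2 : ∀ y ∈ S, ‖h y - h c‖ ≤ K * ‖y - c‖ := by
    intro y hy
    have t1 : Filter.Tendsto (fun x => ‖h y - h x‖) (nhdsWithin c S) (nhds ‖h y - h c‖) :=
      ((tendsto_const_nhds.sub hdc.continuousAt).norm).mono_left nhdsWithin_le_nhds
    have t2 : Filter.Tendsto (fun x => K * ‖y - x‖) (nhdsWithin c S) (nhds (K * ‖y - c‖)) := by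
      refine Filter.Tendsto.mono_left ?_ nhdsWithin_le_nhds
      exact (Continuous.tendsto (by fun_prop) c)
    refine le_of_tendsto_of_tendsto t1 t2 ?_
    filter_upwards [self_mem_nhdsWithin] with x hx
    exact h1 x hx y hy
  have t3 : Filter.Tendsto (slope h c) (nhdsWithin c S) (nhds (deriv h c)) :=
    (hasDerivAt_iff_tendsto_slope.1 hdc.hasDerivAt).mono_left
      (nhdsWithin_mono _ fun x hx => (hS x hx).2)
  refine le_of_tendsto t3.norm ?_
  filter_upwards [self_mem_nhdsWithin] with x hx
  have h3 := h2 x hx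
  have h4 : 0 < ‖x - c‖ := norm_pos_iff.2 (sub_ne_zero.2 (hS x hx).2)
  rw [slope_def_module, norm_smul, norm_inv, inv_mul_le_iff₀ h4, mul_comm]
  exact h3


lemma clos_le {G : Type} [NormedAddCommGroup G] {g : ℝ × ℝ → G} {S : Set (ℝ × ℝ)} {p : ℝ × ℝ}
    (hp : p ∈ closure S) (hg : ContinuousAt g p) {K : ℝ} (h : ∀ q ∈ S, ‖g q‖ ≤ K) : ‖g p‖ ≤ K := by
  have := mem_closure_iff_nhdsWithin_neBot.1 hp
  refine le_of_tendsto ((hg.norm).tendsto.mono_left (nhdsWithin_le_nhds (s := S))) ?_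
  filter_upwards [self_mem_nhdsWithin] with q hq
  exact h q hq

lemma closure_sq {α β : ℝ} (h : α < β) :
    closure (Ioo α β ×ˢ Ioo α β) = Icc α β ×ˢ Icc α β := by
  rw [closure_prod_eq, closure_Ioo h.ne]

lemma facR_le_gamma {s : ℝ} (n : ℕ) :
    facR (1 / s) n ≤ 4 * GammaS s n * 2 ^ n := by
  have h : ((n:ℝ) + 1) ^ 2 ≤ 4 * 2 ^ n := by
    have : ∀ n : ℕ, (n + 1) ^ 2 ≤ 4 * 2 ^ n := by
      intro n
      induction n with
      | zero => norm_num
      | succ n ih =>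
        rcases Nat.lt_or_ge n 2 with h | h
        · interval_cases n <;> norm_num
        · rw [pow_succ 2 n]; nlinarith
    exact_mod_cast this n
  have h2 : GammaS s n = facR (1 / s) n / ((n:ℝ) + 1) ^ 2 := rfl
  have h3 := facR_pos (1 / s) n
  rw [h2]
  have : facR (1 / s) n = facR (1 / s) n / ((n:ℝ) + 1) ^ 2 * ((n:ℝ) + 1) ^ 2 := by field_simp
  calc _ = _ := this
    _ ≤ facR (1 / s) n / ((n:ℝ) + 1) ^ 2 * (4 * 2 ^ n) := by gcongr
    _ = _ := by ring

lemma gamma_le {s : ℝ} (n : ℕ) : GammaS s n ≤ facR (1 / s) n := by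
  have h2 : GammaS s n = facR (1 / s) n / ((n:ℝ) + 1) ^ 2 := rfl
  have h3 := facR_pos (1 / s) n
  rw [h2]
  refine div_le_self h3.le ?_
  have : (0:ℝ) ≤ n := by positivity
  nlinarith

lemma gamma_pos {s : ℝ} (n : ℕ) : 0 < GammaS s n := by
  have h2 : GammaS s n = facR (1 / s) n / ((n:ℝ) + 1) ^ 2 := rfl
  have h3 := facR_pos (1 / s) n
  rw [h2]; positivity

lemma facR_succ_le {r : ℝ} (hr : 1 < r) (n : ℕ) : facR r n ≤ facR r (n + 1) := by
  refine Real.rpow_le_rpow (by positivity) ?_ (by linarith)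
  exact_mod_cast Nat.factorial_le (Nat.le_succ n)

lemma one_bound {r : ℝ} (hr : 1 < r) {κ : ℝ} (hκ : 1 ≤ κ) (p : ℝ × ℝ) (i : ℕ) :
    ‖iteratedFDeriv ℝ i (fun _ : ℝ × ℝ => (1:ℝ)) p‖ ≤ 1 * facR r i * (2 * κ) ^ i := by
  have := facR_pos r i
  match i with
  | 0 => simp [facR_zero]
  | i + 1 =>
    rw [iteratedFDeriv_succ_const]
    simp only [Pi.zero_apply, norm_zero]
    positivity

/-- bounds for the quotient -/
lemma quot_bound {f : ℝ → ℝ → ℂ} (hf : ContDiff ℝ (⊤ : ℕ∞) (unc f)) {H : ℝ × ℝ → ℂ}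
    (hH : ContDiff ℝ (⊤ : ℕ∞) H) {α β k2 : ℝ} (hαβ : α < β) (hk2 : 0 ≤ k2)
    (heq : ∀ p ∈ Ioo α β ×ˢ Ioo α β, unc f p = 1 + k2 • (qv p • H p))
    {a b : ℕ} {K : ℝ} (hK : 0 ≤ K)
    (hb : ∀ p ∈ Ioo α β ×ˢ Ioo α β, k2 * ‖iteratedFDeriv ℝ (a + b) H p‖ ≤ K)
    {x c : ℝ} (hx : x ∈ Icc α β) (hc : c ∈ Icc α β) :
    ‖(pd1^[a] (pd2^[b] (fun x' c' => (f x' c' - 1) / ((x' : ℂ) - (c' : ℂ)) ^ 2))) x c‖ ≤ K := by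
  set F : ℝ → ℝ → ℂ := fun x' c' => (f x' c' - 1) / ((x' : ℂ) - (c' : ℂ)) ^ 2 with hF
  set U : Set (ℝ × ℝ) := {p | p.1 ≠ p.2} with hUdef
  have hU : IsOpen U := isOpen_ne_fun continuous_fst continuous_snd
  have hn : ∀ n : ℕ, (n : WithTop ℕ∞) ≤ ((⊤ : ℕ∞) : WithTop ℕ∞) := by
    intro n; exact_mod_cast le_top
  have hne : ∀ p ∈ U, ((p.1 : ℂ) - (p.2 : ℂ)) ^ 2 ≠ 0 := by
    intro p hp
    refine pow_ne_zero 2 (sub_ne_zero.2 ?_)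
    exact_mod_cast hp
  have hsm : SmOn U F := by
    intro p hp
    have h1 : ContDiff ℝ (⊤ : ℕ∞) (fun p : ℝ × ℝ => ((p.1 : ℂ) - (p.2 : ℂ)) ^ 2) :=
      ((Complex.ofRealCLM.contDiff.comp contDiff_fst).sub
        (Complex.ofRealCLM.contDiff.comp contDiff_snd)).pow 2
    have h2 : ContDiffAt ℝ (⊤ : ℕ∞) (fun p : ℝ × ℝ => (((p.1 : ℂ) - (p.2 : ℂ)) ^ 2)⁻¹) p :=
      h1.contDiffAt.inv (hne p hp)
    have h3 : ContDiffAt ℝ (⊤ : ℕ∞) (fun p : ℝ × ℝ => unc f p - 1) p :=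
      hf.contDiffAt.sub contDiffAt_const
    have h4 := h3.mul h2
    have e : unc F = fun p => (unc f p - 1) * (((p.1 : ℂ) - (p.2 : ℂ)) ^ 2)⁻¹ := by
      funext q; exact div_eq_mul_inv _ _
    rw [e]; exact h4
  -- open square, off diagonal
  have hQo : IsOpen (Ioo α β ×ˢ Ioo α β) := isOpen_Ioo.prod isOpen_Ioo
  have o1 : ∀ p ∈ U ∩ (Ioo α β ×ˢ Ioo α β), ‖iteratedFDeriv ℝ (a + b) (unc F) p‖ ≤ K := by
    rintro p hp
    have he : unc F =ᶠ[nhds p] k2 • H := by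
      filter_upwards [(hU.inter hQo).mem_nhds hp] with q hq
      have h1 := heq q hq.2
      have h2 := hne q hq.1
      show (unc f q - 1) / ((q.1 : ℂ) - (q.2 : ℂ)) ^ 2 = k2 • H q
      rw [h1, div_eq_iff h2, qv]
      simp only [Complex.real_smul]
      push_cast
      ring
    rw [(he.iteratedFDeriv ℝ (a + b)).eq_of_nhds,
      iteratedFDeriv_const_smul_apply (hH.of_le (hn _)).contDiffAt, norm_smul, Real.norm_eq_abs,
      abs_of_nonneg hk2]
    exact hb p hp.2
  have o2 : ∀ p ∈ U, p ∈ Icc α β ×ˢ Icc α β → ‖iteratedFDeriv ℝ (a + b) (unc F) p‖ ≤ K := by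
    intro p hp hpQ
    refine clos_le (S := U ∩ (Ioo α β ×ˢ Ioo α β)) ?_
      ((hsm p hp).continuousAt_iteratedFDeriv (hn _)) o1
    apply hU.inter_closure
    rw [closure_sq hαβ]
    exact ⟨hp, hpQ⟩
  have o3 : ∀ x ∈ Icc α β, ∀ c ∈ Icc α β, x ≠ c → ‖(pd1^[a] (pd2^[b] F)) x c‖ ≤ K :=
    fun x hx c hc hxc => ((pd_bound hU hsm a b).2 (x, c) hxc).trans (o2 (x, c) hxc ⟨hx, hc⟩)
  by_cases hxc : x = c
  swap
  · exact o3 x hx c hc hxc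
  subst hxc
  match a, b with
  | 0, 0 => simpa [hF] using hK
  | a + 1, b =>
    rw [Function.iterate_succ_apply'] at o3 ⊢
    refine deriv_diag (h := fun y => (pd1^[a] (pd2^[b] F)) y x) hαβ hc hK fun y hy hyx => ⟨?_, ?_⟩
    · exact (pd1_eq (p := (y, x))
        (((pd_bound hU hsm a b).1 (y, x) hyx).differentiableAt (by simp))).differentiableAt
    · exact o3 y hy x hc hyx
  | 0, b + 1 =>
    simp only [Function.iterate_zero, id_eq] at o3 ⊢
    rw [Function.iterate_succ_apply'] at o3 ⊢
    refine deriv_diag (h := fun y => (pd2^[b] F) x y) hαβ hc hK fun y hy hyx => ⟨?_, ?_⟩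
    · exact (pd2_eq (p := (x, y))
        (((pd_bound hU hsm 0 b).1 (x, y) (Ne.symm hyx)).differentiableAt (by simp))).differentiableAt
    · exact o3 x hc y hy (Ne.symm hyx)

/-- Let `Φ₁(k,·,·)` solve the fixed point equation
`Φ₁ = 1 + k² (T₀ ∘ T_{2,2}) Φ₁` on `[u(0),u(1)]²`.  Then there exist `M₀` and constants
`C(k) > 0`, `C ≥ 1` such that for every `k ≠ 0`, all integers `m ≥ m₁ ≥ 0` and all `M ≥ M₀`:
(i)  `|∂_u^{m₁}∂_c^{m−m₁}Φ₁(k,u,c)| ≤ C(k) Γ_{s₀}(m)(2M)^m|k|^m` on `[u(0),u(1)]²`;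
(ii) `|∂_u^{m₁}∂_c^{m−m₁}((Φ₁(k,u,c)−1)/(u−c)²)| ≤ C(k) Γ_{s₀}(m)(CM)^m|k|^m`. -/
theorem statement19
    (u : ℝ → ℝ) (hu : ContDiff ℝ (⊤ : ℕ∞) u) (hmono : StrictMonoOn u (Icc 0 1))
    (uinv : ℝ → ℝ) (huinv_smooth : ContDiff ℝ (⊤ : ℕ∞) uinv)
    (huinv : ∀ y ∈ Icc (0 : ℝ) 1, uinv (u y) = y)
    (Ku s₀ : ℝ) (hKu : 0 < Ku) (hs₀ : s₀ ∈ Ioo (0 : ℝ) 1)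
    (B : ℝ)
    (hGev : ∀ (m j : ℕ), j ≤ m → ∀ x ∈ Icc (u 0) (u 1),
      |iteratedDeriv j (deriv (deriv uinv)) x| ≤ B * GammaS s₀ m * Ku ^ m)
    (Φ₁ : ℤ → ℝ → ℝ → ℂ)
    (hΦsmooth : ∀ k : ℤ, ContDiff ℝ (⊤ : ℕ∞) (fun p : ℝ × ℝ => Φ₁ k p.1 p.2))
    (hΦeq : ∀ k : ℤ, k ≠ 0 → ∀ x ∈ Icc (u 0) (u 1), ∀ c ∈ Icc (u 0) (u 1),
      Φ₁ k x c = 1 + (k : ℂ) ^ 2 *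
        T0op (T22op (fun y => deriv uinv y) (Φ₁ k)) x c) :
    ∃ M₀ ≥ (1 : ℝ), ∃ C ≥ (1 : ℝ), ∀ k : ℤ, k ≠ 0 → ∃ Ck > (0 : ℝ), ∀ M ≥ M₀,
      ∀ (m m₁ : ℕ), m₁ ≤ m → ∀ x ∈ Icc (u 0) (u 1), ∀ c ∈ Icc (u 0) (u 1),
        ‖(pd1^[m₁] (pd2^[m - m₁] (Φ₁ k))) x c‖
            ≤ Ck * GammaS s₀ m * (2 * M) ^ m * |(k : ℝ)| ^ m ∧
        ‖(pd1^[m₁] (pd2^[m - m₁]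
              (fun x' c' => (Φ₁ k x' c' - 1) / ((x' : ℂ) - (c' : ℂ)) ^ 2))) x c‖
            ≤ Ck * GammaS s₀ m * (C * M) ^ m * |(k : ℝ)| ^ m := by
  have hαβ : u 0 < u 1 := hmono (by simp) (by simp) one_pos
  set α := u 0 with hα
  set β := u 1 with hβ
  set r := 1 / s₀ with hrdef
  have hr : 1 < r := by rw [hrdef, lt_div_iff₀ hs₀.1, one_mul]; exact hs₀.2
  set w : ℝ → ℝ := fun y => deriv uinv y with hwdef
  have hw : ContDiff ℝ (⊤ : ℕ∞) w := by
    have : ContDiff ℝ (⊤ : ℕ∞) (deriv uinv) :=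
      ((contDiff_infty_iff_deriv).1 huinv_smooth).2
    exact this
  obtain ⟨C0, hC0⟩ := (isCompact_Icc (a := α) (b := β)).exists_bound_of_continuousOn
    hw.continuous.continuousOn
  set W := |C0| + |B| with hWdef
  have hW : 0 ≤ W := by positivity
  set κ := Ku + 1 with hκdef
  have hκ : 1 ≤ κ := by linarith
  have hwb : ∀ x ∈ Ioo α β, ∀ i, |iteratedDeriv i w x| ≤ W * facR r i * κ ^ i := by
    intro x hx i
    match i with
    | 0 =>
      have := hC0 x (Ioo_subset_Icc_self hx)
      rw [Real.norm_eq_abs] at this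
      simp only [iteratedDeriv_zero, facR_zero, pow_zero, mul_one]
      have h1 := le_abs_self C0
      have h2 := abs_nonneg B
      linarith
    | i + 1 =>
      rw [iteratedDeriv_succ']
      have h1 := hGev i i le_rfl x (Ioo_subset_Icc_self hx)
      have g0 := gamma_pos (s := s₀) i
      have g1 : GammaS s₀ i ≤ facR r (i + 1) := (gamma_le i).trans (facR_succ_le hr i)
      have g2 : B ≤ W := by
        have h1 := le_abs_self B
        have h2 := abs_nonneg C0
        linarith
      have g3 : Ku ^ i ≤ κ ^ (i + 1) := by
        calc Ku ^ i ≤ κ ^ i := pow_le_pow_left₀ hKu.le (by linarith) i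
          _ ≤ κ ^ (i + 1) := pow_le_pow_right₀ hκ (Nat.le_succ i)
      have g4 := facR_pos r (i + 1)
      calc _ ≤ _ := h1
        _ ≤ W * GammaS s₀ i * Ku ^ i := by gcongr
        _ ≤ W * facR r (i + 1) * κ ^ (i + 1) := by gcongr
  refine ⟨16 * κ, by linarith, 2, by norm_num, fun k hk => ?_⟩
  set P : ℝ × ℝ → ℂ := unc (Φ₁ k) with hPdef
  have hP : ContDiff ℝ (⊤ : ℕ∞) P := hΦsmooth k
  set k2 : ℝ := (k : ℝ) ^ 2 with hk2def
  have hk2 : 0 ≤ k2 := by positivity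
  have heq : ∀ p ∈ Ioo α β ×ˢ Ioo α β, P p = 1 + k2 • HI qv w P p := by
    intro p hp
    have h1 := hΦeq k hk p.1 (Ioo_subset_Icc_self hp.1) p.2 (Ioo_subset_Icc_self hp.2)
    rw [T_eq] at h1
    rw [Complex.real_smul, hk2def]
    push_cast
    exact h1
  obtain ⟨K, hK, hKb⟩ := main1 hw hP hr hαβ hW hk2 hκ hwb heq
  have hH : ContDiff ℝ (⊤ : ℕ∞) (HI (fun _ => 1) w P) := HI_contDiff contDiff_const hw hP
  have hHb : ∀ p ∈ Ioo α β ×ˢ Ioo α β, ∀ n,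
      ‖iteratedFDeriv ℝ n (HI (fun _ => 1) w P) p‖ ≤ (1 * (W * W) * K) * facR r n * (16 * κ) ^ n :=
    fun p hp n => HI_full contDiff_const hw hP hr zero_le_one hW hκ hK hwb
      (fun p _ i => one_bound hr hκ p i) hKb hp n
  set K2 := k2 * (1 * (W * W) * K) with hK2
  have hK20 : 0 ≤ K2 := by positivity
  refine ⟨4 * K + 4 * K2 + 1, by positivity, fun M hM m m₁ hm x hx c hc => ?_⟩
  have hM0 : 0 ≤ M := by linarith
  have hkabs : 1 ≤ |(k : ℝ)| ^ m := by
    apply one_le_pow₀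
    exact_mod_cast Int.one_le_abs hk
  have gp := gamma_pos (s := s₀) m
  have fg := facR_le_gamma (s := s₀) m
  have hmm : m₁ + (m - m₁) = m := by omega
  have hsq : ∀ p ∈ Icc α β ×ˢ Icc α β, ‖iteratedFDeriv ℝ m P p‖ ≤ K * facR r m * (8 * κ) ^ m := by
    intro p hp
    refine clos_le (S := Ioo α β ×ˢ Ioo α β) (by rw [closure_sq hαβ]; exact hp)
      (hP.continuous_iteratedFDeriv (by exact_mod_cast le_top)).continuousAt
      (fun q hq => hKb q hq m)
  have fin : ∀ A D, 0 ≤ A → 4 * A ≤ 4 * K + 4 * K2 + 1 → 0 ≤ D → 2 * D ≤ 2 * M →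
      A * facR r m * D ^ m ≤
        (4 * K + 4 * K2 + 1) * GammaS s₀ m * (2 * M) ^ m * |(k : ℝ)| ^ m := by
    intro A D hA hA4 hD0 hD
    calc A * facR r m * D ^ m ≤ A * (4 * GammaS s₀ m * 2 ^ m) * D ^ m := by gcongr
      _ = (4 * A) * GammaS s₀ m * (2 * D) ^ m := by rw [mul_pow]; ring
      _ ≤ (4 * K + 4 * K2 + 1) * GammaS s₀ m * (2 * M) ^ m := by gcongr
      _ ≤ _ := le_mul_of_one_le_right (by positivity) hkabs
  constructor
  · have h1 := (pd_bound isOpen_univ (f := Φ₁ k) (fun p _ => hP.contDiffAt) m₁ (m - m₁)).2 (x, c)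
      (mem_univ _)
    rw [hmm] at h1
    refine (h1.trans (hsq (x, c) ⟨hx, hc⟩)).trans ?_
    exact fin K (8 * κ) hK (by linarith) (by linarith) (by linarith)
  · have e0 := facR_pos r m
    refine (quot_bound (f := Φ₁ k) hP hH hαβ hk2 (K := K2 * facR r m * (16 * κ) ^ m) ?_
      (by positivity) ?_ hx hc).trans ?_
    · intro p hp
      rw [← HI_qv]; exact heq p hp
    · intro p hp
      rw [hmm]
      refine (mul_le_mul_of_nonneg_left (hHb p hp m) hk2).trans_eq ?_
      rw [hK2]; ring
    · exact fin K2 (16 * κ) hK20 (by linarith) (by linarith) (by linarith)
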